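/- Let α be a 2-form on ℝ⁷ with ⋆(α∧ω) = α. Then for all k,m: α_{ij}α_{sp}ω_{jpk}ω_{sim} = −‖α‖²δ_{km} + 4α_{jm}α_{jk} (summing over i,j,s,p on the left and over j on the right), where ‖α‖² = α_{ij}α_{ij}. -/

import Mathlib

open scoped BigOperators

/-- The generalized Kronecker/Levi-Civita epsilon symbol on `Fin 7`. -/
noncomputable def eps (v : Fin 7 → Fin 7) : ℝ :=
  if h : Function.Bijective v then ((Equiv.Perm.sign (Equiv.ofBijective v h) : ℤ) : ℝ) else 0

/-- The basis monomial form `e_{I 0} ∧ ⋯ ∧ e_{I (p-1)}`, given by its components. -/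
noncomputable def mono {p : ℕ} (I : Fin p → Fin 7) : (Fin p → Fin 7) → ℝ :=
  fun v => Matrix.det (Matrix.of fun a b => if I a = v b then (1 : ℝ) else 0)

/-- A (componentwise) `p`-form: totally antisymmetric in its indices. -/
def IsForm {p : ℕ} (c : (Fin p → Fin 7) → ℝ) : Prop :=
  (∀ v : Fin p → Fin 7, ¬ Function.Injective v → c v = 0) ∧
  (∀ (v : Fin p → Fin 7) (σ : Equiv.Perm (Fin p)),
    c (v ∘ σ) = ((Equiv.Perm.sign σ : ℤ) : ℝ) * c v)

/-- Wedge product of forms, in components. -/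
noncomputable def wedge {p q : ℕ} (a : (Fin p → Fin 7) → ℝ) (b : (Fin q → Fin 7) → ℝ) :
    (Fin (p + q) → Fin 7) → ℝ := fun v =>
  (1 / ((Nat.factorial p : ℝ) * (Nat.factorial q : ℝ))) *
    ∑ σ : Equiv.Perm (Fin (p + q)),
      ((Equiv.Perm.sign σ : ℤ) : ℝ) *
        a (fun i => v (σ (Fin.castAdd q i))) * b (fun j => v (σ (Fin.natAdd p j)))

/-- The Hodge star operator (standard metric and orientation on ℝ⁷), in components. -/
noncomputable def hstar {p q : ℕ} (h : p + q = 7) (a : (Fin p → Fin 7) → ℝ) :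
    (Fin q → Fin 7) → ℝ := fun w =>
  (1 / (Nat.factorial p : ℝ)) *
    ∑ v : Fin p → Fin 7, a v * eps (fun i => Fin.append v w (Fin.cast h.symm i))

/-- The fundamental 3-form ω = e₁₂₄+e₂₃₅+e₃₄₆+e₄₅₇+e₅₆₁+e₆₇₂+e₇₁₃ (indices shifted to 0,…,6). -/
noncomputable def ω : (Fin 3 → Fin 7) → ℝ :=
  mono ![0, 1, 3] + mono ![1, 2, 4] + mono ![2, 3, 5] + mono ![3, 4, 6] +
    mono ![4, 5, 0] + mono ![5, 6, 1] + mono ![6, 0, 2]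

/-- The 4-form Φ = −e₃₅₆₇−e₄₆₇₁−e₅₇₁₂−e₆₁₂₃−e₇₂₃₄−e₁₃₄₅−e₂₄₅₆ (indices shifted to 0,…,6). -/
noncomputable def Φ : (Fin 4 → Fin 7) → ℝ :=
  -mono ![2, 4, 5, 6] - mono ![3, 5, 6, 0] - mono ![4, 6, 0, 1] - mono ![5, 0, 1, 2] -
    mono ![6, 1, 2, 3] - mono ![0, 2, 3, 4] - mono ![1, 3, 4, 5]

/-- Components ω_{ijk}. -/
noncomputable def ω3 (i j k : Fin 7) : ℝ := ω ![i, j, k]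

/-- Components ω_{ijkl} = Φ(e_i,e_j,e_k,e_l). -/
noncomputable def ω4 (i j k l : Fin 7) : ℝ := Φ ![i, j, k, l]

/-- Kronecker delta. -/
def δ (i j : Fin 7) : ℝ := if i = j then 1 else 0

/-- Components of a 2-form. -/
def c2 (a : (Fin 2 → Fin 7) → ℝ) (i j : Fin 7) : ℝ := a ![i, j]

/-- The operator α ↦ ⋆(α ∧ ω) on 2-forms. -/
noncomputable def Lω (a : (Fin 2 → Fin 7) → ℝ) : (Fin 2 → Fin 7) → ℝ :=
  hstar (p := 5) (q := 2) rfl (wedge a ω)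

/-- The sign of the ordered pair `(i, j)`, zero on the diagonal. -/
def orient (i j : Fin 7) : ℤ := if i < j then 1 else if j < i then -1 else 0

lemma orient_antisymm (i j : Fin 7) : orient i j = -orient j i := by
  revert i j; decide

/-- The Levi-Civita symbol as an integer product over pairs of positions. -/
def epsInt (v : Fin 7 → Fin 7) : ℤ := ∏ j, ∏ i ∈ Finset.Iio j, orient (v i) (v j)

lemma eps_eq_epsInt (v : Fin 7 → Fin 7) : eps v = (epsInt v : ℝ) := by
  unfold eps epsInt
  split_ifs with h
  · rw [Equiv.Perm.sign_eq_prod_prod_Iio]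
    push_cast
    refine Finset.prod_congr rfl fun j _ => Finset.prod_congr rfl fun i hi => ?_
    have hne : v i ≠ v j := fun he => (Finset.mem_Iio.1 hi).ne (h.1 he)
    simp only [Equiv.ofBijective_apply, orient]
    rcases lt_or_gt_of_ne hne with hlt | hlt
    · simp [hlt]
    · simp [hlt, hlt.not_gt]
  · have hinj : ¬ Function.Injective v := fun hi => h (Finite.injective_iff_bijective.1 hi)
    obtain ⟨i, j, hij, hlt⟩ : ∃ i j, v i = v j ∧ i < j := by
      simp only [Function.Injective, not_forall] at hinj
      obtain ⟨i, j, he, hne⟩ := hinj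
      rcases lt_or_gt_of_ne hne with hlt | hlt
      exacts [⟨i, j, he, hlt⟩, ⟨j, i, he.symm, hlt⟩]
    rw [Finset.prod_eq_zero (Finset.mem_univ j), Int.cast_zero]
    exact Finset.prod_eq_zero (Finset.mem_Iio.2 hlt) (by simp [orient, hij])

lemma eps_comp (v : Fin 7 → Fin 7) (τ : Equiv.Perm (Fin 7)) :
    eps (v ∘ τ) = ((Equiv.Perm.sign τ : ℤ) : ℝ) * eps v := by
  rw [eps_eq_epsInt, eps_eq_epsInt, ← Int.cast_mul]
  congr 1
  simpa [epsInt] using τ.prod_Iio_comp_eq_sign_mul_prod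
    (f := fun i j => orient (v i) (v j)) fun i j => orient_antisymm _ _

lemma eps_append_comp_left {p q : ℕ} (h : 7 = p + q) (v : Fin p → Fin 7) (w : Fin q → Fin 7)
    (σ : Equiv.Perm (Fin p)) :
    eps (fun i => Fin.append (v ∘ σ) w (Fin.cast h i)) =
      ((Equiv.Perm.sign σ : ℤ) : ℝ) * eps (fun i => Fin.append v w (Fin.cast h i)) := by
  let e : Fin p ⊕ Fin q ≃ Fin 7 := finSumFinEquiv.trans (finCongr h.symm)
  have hs : Equiv.Perm.sign (e.permCongr (Equiv.Perm.sumCongr σ 1)) = Equiv.Perm.sign σ := by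
    rw [Equiv.Perm.sign_permCongr, Equiv.Perm.sign_sumCongr, map_one, mul_one]
  rw [← hs, ← eps_comp]
  congr 1
  funext i
  obtain ⟨x, rfl⟩ := e.surjective i
  rcases x with x | x <;> simp [e, Equiv.permCongr_apply]

lemma eps_append_comp_middle {p q r : ℕ} (h : 7 = p + q + r) (u : Fin p → Fin 7)
    (v : Fin q → Fin 7) (w : Fin r → Fin 7) (σ : Equiv.Perm (Fin q)) :
    eps (fun i => Fin.append (Fin.append u (v ∘ σ)) w (Fin.cast h i)) =
      ((Equiv.Perm.sign σ : ℤ) : ℝ) *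
        eps (fun i => Fin.append (Fin.append u v) w (Fin.cast h i)) := by
  have hs : Equiv.Perm.sign (finSumFinEquiv.permCongr
      (Equiv.Perm.sumCongr (1 : Equiv.Perm (Fin p)) σ)) = Equiv.Perm.sign σ := by
    rw [Equiv.Perm.sign_permCongr, Equiv.Perm.sign_sumCongr, map_one, one_mul]
  rw [← hs, ← eps_append_comp_left]
  congr! 3
  funext i
  refine Fin.addCases (fun x => ?_) (fun x => ?_) i <;> simp [Equiv.permCongr_apply]

/-- The Hodge star of a wedge product, without antisymmetrization of the factors. -/
lemma hstar_wedge {p q r : ℕ} (h : p + q + r = 7) (a : (Fin p → Fin 7) → ℝ)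
    (b : (Fin q → Fin 7) → ℝ) (w : Fin r → Fin 7) :
    hstar h (wedge a b) w = (1 / ((Nat.factorial p : ℝ) * (Nat.factorial q : ℝ))) *
      ∑ v : Fin (p + q) → Fin 7, a (fun i => v (Fin.castAdd q i)) *
        b (fun j => v (Fin.natAdd p j)) * eps (fun i => Fin.append v w (Fin.cast h.symm i)) := by
  set F : (Fin (p + q) → Fin 7) → ℝ := fun v => a (fun i => v (Fin.castAdd q i)) *
    b (fun j => v (Fin.natAdd p j)) * eps (fun i => Fin.append v w (Fin.cast h.symm i)) with hF
  have key (σ : Equiv.Perm (Fin (p + q))) :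
      ∑ v : Fin (p + q) → Fin 7, ((Equiv.Perm.sign σ : ℤ) : ℝ) *
        a (fun i => v (σ (Fin.castAdd q i))) * b (fun j => v (σ (Fin.natAdd p j))) *
          eps (fun i => Fin.append v w (Fin.cast h.symm i)) = ∑ v, F v := by
    rw [← Equiv.sum_comp (σ.symm.arrowCongr (Equiv.refl (Fin 7))) F]
    refine Finset.sum_congr rfl fun v _ => ?_
    have hv : σ.symm.arrowCongr (Equiv.refl (Fin 7)) v = v ∘ σ := by
      funext i; simp [Equiv.arrowCongr]
    rw [hv, hF]
    simp only [Function.comp_apply, eps_append_comp_left]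
    ring
  have hfac : ((Nat.factorial (p + q) : ℕ) : ℝ) ≠ 0 := by positivity
  calc hstar h (wedge a b) w
      = (1 / (Nat.factorial (p + q) : ℝ)) * ((1 / ((Nat.factorial p : ℝ) * Nat.factorial q)) *
          ∑ σ : Equiv.Perm (Fin (p + q)), ∑ v : Fin (p + q) → Fin 7,
            ((Equiv.Perm.sign σ : ℤ) : ℝ) * a (fun i => v (σ (Fin.castAdd q i))) *
              b (fun j => v (σ (Fin.natAdd p j))) *
                eps (fun i => Fin.append v w (Fin.cast h.symm i))) := by
        rw [Finset.sum_comm, Finset.mul_sum]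
        simp only [hstar, wedge, Finset.sum_mul, mul_assoc]
    _ = _ := by
        simp only [key, Finset.sum_const, Finset.card_univ, Fintype.card_perm, Fintype.card_fin,
          nsmul_eq_mul]
        field_simp

/-- Contracting a basis monomial with an alternating family picks out one component. -/
lemma sum_mono_mul {p : ℕ} (I : Fin p → Fin 7) (f : (Fin p → Fin 7) → ℝ)
    (hf : ∀ v (σ : Equiv.Perm (Fin p)), f (v ∘ σ) = ((Equiv.Perm.sign σ : ℤ) : ℝ) * f v) :
    ∑ v, mono I v * f v = (Nat.factorial p : ℝ) * f I := by
  have key (σ : Equiv.Perm (Fin p)) :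
      ∑ v : Fin p → Fin 7, (((Equiv.Perm.sign σ : ℤ) : ℝ) *
        ∏ i, if I (σ i) = v i then (1 : ℝ) else 0) * f v = f I := by
    have hprod (v : Fin p → Fin 7) :
        (∏ i, if I (σ i) = v i then (1 : ℝ) else 0) = if I ∘ σ = v then 1 else 0 := by
      simp [Finset.prod_ite_zero, funext_iff]
    simp only [hprod, mul_ite, mul_one, mul_zero, ite_mul, zero_mul, Finset.sum_ite_eq,
      Finset.mem_univ, if_true, hf, ← mul_assoc, ← Int.cast_mul]
    simp [Int.units_coe_mul_self]
  simp only [mono, Matrix.det_apply', Matrix.of_apply, Finset.sum_mul]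
  rw [Finset.sum_comm]
  simp [key, Fintype.card_perm]

/-- The seven lines of the Fano plane indexing the monomials of `ω`. -/
def fanoLine (l : Fin 7) : Fin 3 → Fin 7 := ![l, l + 1, l + 3]

lemma omega_eq_sum : ω = ∑ l, mono (fanoLine l) := by
  simp [Fin.sum_univ_seven, ω, fanoLine]

/-- The integer kernel of `α ↦ 2 ⋆(α ∧ ω)`. -/
def starKernel (s w : Fin 2 → Fin 7) : ℤ :=
  ∑ l, epsInt fun i => Fin.append (Fin.append s (fanoLine l)) w i

lemma Lω_apply (a : (Fin 2 → Fin 7) → ℝ) (w : Fin 2 → Fin 7) :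
    Lω a w = (1 / 2) * ∑ s : Fin 2 → Fin 7, a s * starKernel s w := by
  have key (s : Fin 2 → Fin 7) :
      ∑ u : Fin 3 → Fin 7, ω u * eps (Fin.append (Fin.append s u) w) =
        6 * (starKernel s w : ℝ) := by
    simp only [omega_eq_sum, Finset.sum_apply, Finset.sum_mul, starKernel]
    rw [Finset.sum_comm]
    push_cast
    rw [Finset.mul_sum]
    refine Finset.sum_congr rfl fun l _ => ?_
    rw [sum_mono_mul, ← eps_eq_epsInt]
    · norm_num [Nat.factorial]
    · intro v σ
      exact eps_append_comp_middle (p := 2) (q := 3) (r := 2) rfl s v w σ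
  rw [Lω, hstar_wedge (p := 2) (q := 3) (r := 2) rfl,
    ← Equiv.sum_comp (Fin.appendEquiv 2 3), Fintype.sum_prod_type]
  simp only [Fin.appendEquiv, Equiv.coe_fn_mk, Fin.append_left, Fin.append_right, mul_assoc,
    ← Finset.mul_sum]
  have key' (s : Fin 2 → Fin 7) :
      ∑ u : Fin 3 → Fin 7, ω u * eps (fun i => Fin.append (Fin.append s u) w
        (Fin.cast (by rfl) i)) = 6 * (starKernel s w : ℝ) := key s
  simp only [key', mul_left_comm _ (6 : ℝ), ← Finset.mul_sum]
  norm_num [Nat.factorial]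
  ring

lemma starKernel_line (z i j : Fin 7) : starKernel ![i, j] ![z + 1, z + 3] =
    (if i = z + 6 ∧ j = z + 2 then 1 else 0) - (if i = z + 2 ∧ j = z + 6 then 1 else 0) +
    ((if i = z + 5 ∧ j = z + 4 then 1 else 0) - (if i = z + 4 ∧ j = z + 5 then 1 else 0)) := by
  revert z i j; decide +kernel

/-- The components of `ω`, read off from the lines through the last index. -/
lemma ω3_eq (i j k : Fin 7) : ω3 i j k =
    (if i = k + 1 ∧ j = k + 3 then 1 else 0) - (if i = k + 3 ∧ j = k + 1 then 1 else 0) +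
    ((if i = k + 2 ∧ j = k + 6 then 1 else 0) - (if i = k + 6 ∧ j = k + 2 then 1 else 0)) +
    ((if i = k + 4 ∧ j = k + 5 then 1 else 0) - (if i = k + 5 ∧ j = k + 4 then 1 else 0)) := by
  have h : ∀ i j k : Fin 7, ∑ l, Matrix.det (Matrix.of fun a b : Fin 3 =>
      if fanoLine l a = ![i, j, k] b then (1 : ℤ) else 0) =
    (if i = k + 1 ∧ j = k + 3 then 1 else 0) - (if i = k + 3 ∧ j = k + 1 then 1 else 0) +
    ((if i = k + 2 ∧ j = k + 6 then 1 else 0) - (if i = k + 6 ∧ j = k + 2 then 1 else 0)) +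
    ((if i = k + 4 ∧ j = k + 5 then 1 else 0) - (if i = k + 5 ∧ j = k + 4 then 1 else 0)) := by
    simp only [Matrix.det_fin_three]
    decide +kernel
  have hmono (l : Fin 7) : mono (fanoLine l) ![i, j, k] = (Matrix.det (Matrix.of fun a b : Fin 3 =>
      if fanoLine l a = ![i, j, k] b then (1 : ℤ) else 0) : ℤ) := by
    rw [mono, Int.cast_det]
    congr 1
    ext a b
    simp
  rw [ω3, omega_eq_sum]
  simp only [Finset.sum_apply, hmono, ← Int.cast_sum, h]
  push_cast
  rfl

lemma sum_sum_mul_ω3 (f : Fin 7 → Fin 7 → ℝ) (k : Fin 7) :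
    ∑ i, ∑ j, f i j * ω3 i j k = f (k + 1) (k + 3) - f (k + 3) (k + 1) +
      (f (k + 2) (k + 6) - f (k + 6) (k + 2)) + (f (k + 4) (k + 5) - f (k + 5) (k + 4)) := by
  simp [ω3_eq, mul_add, mul_sub, Finset.sum_add_distrib, Finset.sum_sub_distrib, ite_and]

lemma c2_antisymm {a : (Fin 2 → Fin 7) → ℝ} (ha : IsForm a) (i j : Fin 7) :
    c2 a i j = -c2 a j i := by
  have h := ha.2 ![j, i] (Equiv.swap 0 1)
  have hv : ![j, i] ∘ Equiv.swap (0 : Fin 2) 1 = ![i, j] := by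
    funext x; fin_cases x <;> simp
  rw [hv, Equiv.Perm.sign_swap (by decide)] at h
  simpa [c2] using h

/-- A 2-form fixed by `α ↦ ⋆(α ∧ ω)` satisfies `α_{ij} ω_{ijz} = 0`. -/
lemma c2_line_sum_eq_zero {a : (Fin 2 → Fin 7) → ℝ} (ha : IsForm a) (h14 : Lω a = a)
    (z : Fin 7) :
    c2 a (z + 1) (z + 3) + c2 a (z + 2) (z + 6) + c2 a (z + 4) (z + 5) = 0 := by
  have h := congrFun h14 ![z + 1, z + 3]
  rw [Lω_apply, ← Equiv.sum_comp (finTwoArrowEquiv (Fin 7)).symm, Fintype.sum_prod_type] at h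
  simp only [finTwoArrowEquiv_symm_apply, starKernel_line] at h
  push_cast at h
  change _ * ∑ i, ∑ j, c2 a i j * _ = c2 a (z + 1) (z + 3) at h
  simp only [mul_add, mul_sub, Finset.sum_add_distrib, Finset.sum_sub_distrib, ite_and, mul_ite,
    mul_one, mul_zero, Finset.sum_ite_eq', Finset.mem_univ, if_true,
    Finset.sum_ite_irrel, Finset.sum_const_zero] at h
  linarith [c2_antisymm ha (z + 2) (z + 6), c2_antisymm ha (z + 4) (z + 5)]

/-- The quartic contraction for an antisymmetric matrix annihilated by contraction with `ω`. -/
lemma contraction_of_line_sums {A : Fin 7 → Fin 7 → ℝ} (hA : ∀ i j, A i j = -A j i)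
    (hline : ∀ z, A (z + 1) (z + 3) + A (z + 2) (z + 6) + A (z + 4) (z + 5) = 0) (k m : Fin 7) :
    (∑ i, ∑ j, ∑ s, ∑ p, A i j * A s p * ω3 j p k * ω3 s i m) =
      -(∑ i, ∑ j, A i j * A i j) * δ k m + 4 * ∑ j, A j m * A j k := by
  have hL : (∑ i, ∑ j, ∑ s, ∑ p, A i j * A s p * ω3 j p k * ω3 s i m) =
      ∑ s, ∑ i, (∑ j, ∑ p, (A i j * A s p) * ω3 j p k) * ω3 s i m := by
    symm
    rw [Finset.sum_comm]
    simp only [Finset.sum_mul]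
    exact Finset.sum_congr rfl fun i _ => Finset.sum_comm
  rw [hL, sum_sum_mul_ω3]
  simp only [sum_sum_mul_ω3]
  have hd (i : Fin 7) : A i i = 0 := by linarith [hA i i]
  have e13 : A 1 3 = -A 2 6 - A 4 5 := by
    linarith [show A 1 3 + A 2 6 + A 4 5 = 0 from hline 0]
  have e24 : A 2 4 = A 0 3 - A 5 6 := by
    linarith [show A 2 4 + A 3 0 + A 5 6 = 0 from hline 1, hA 3 0]
  have e35 : A 3 5 = A 1 4 + A 0 6 := by
    linarith [show A 3 5 + A 4 1 + A 6 0 = 0 from hline 2, hA 4 1, hA 6 0]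
  have e46 : A 4 6 = A 2 5 - A 0 1 := by
    linarith [show A 4 6 + A 5 2 + A 0 1 = 0 from hline 3, hA 5 2]
  have e12 : A 1 2 = A 0 5 + A 3 6 := by
    linarith [show A 5 0 + A 6 3 + A 1 2 = 0 from hline 4, hA 5 0, hA 6 3]
  have e23 : A 2 3 = A 1 6 - A 0 4 := by
    linarith [show A 6 1 + A 0 4 + A 2 3 = 0 from hline 5, hA 6 1]
  have e02 : A 0 2 = -A 1 5 - A 3 4 := by
    linarith [show A 0 2 + A 1 5 + A 3 4 = 0 from hline 6]
  fin_cases k <;> fin_cases m <;>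
    simp only [Fin.isValue, Fin.reduceAdd, Fin.sum_univ_seven, δ, Fin.zero_eta, Fin.mk_one,
      Fin.reduceFinMk, zero_add, Fin.reduceEq, if_true, if_false, hd,
      hA 1 0, hA 2 0, hA 3 0, hA 4 0, hA 5 0, hA 6 0, hA 2 1, hA 3 1, hA 4 1, hA 5 1, hA 6 1,
      hA 3 2, hA 4 2, hA 5 2, hA 6 2, hA 4 3, hA 5 3, hA 6 3, hA 5 4, hA 6 4, hA 6 5,
      e13, e24, e35, e46, e12, e23, e02] <;>
    ring

/-- for α ∈ Λ²₁₄, α_{ij}α_{sp}ω_{jpk}ω_{sim} = −‖α‖²δ_{km} + 4α_{jm}α_{jk}. -/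
theorem lambda14_quartic_contraction (a : (Fin 2 → Fin 7) → ℝ)
    (ha : IsForm a) (h14 : Lω a = a) (k m : Fin 7) :
    (∑ i : Fin 7, ∑ j : Fin 7, ∑ s : Fin 7, ∑ p : Fin 7,
        c2 a i j * c2 a s p * ω3 j p k * ω3 s i m) =
      -(∑ i : Fin 7, ∑ j : Fin 7, c2 a i j * c2 a i j) * δ k m +
        4 * ∑ j : Fin 7, c2 a j m * c2 a j k := by
  exact contraction_of_line_sums (c2_antisymm ha) (c2_line_sum_eq_zero ha h14) k m
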